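/- Let Γ_UCB be the single-index strategy. Then for every N ≥ 2 and every θ ∈ [0,1]^N with maximal coordinate θ_{i*}, the loss over a block of length T > N satisfies L(θ;Γ_UCB,T) ≤ B·[ Σ_{i : θ_i < θ_{i*}} 8·ln T/(θ_{i*} − θ_i) + (1 + π²/3)·Σ_{i=1}^N (θ_{i*} − θ_i) ]. In particular L(θ;Γ_UCB,T) = O(ln T) for every fixed θ, so the single-index strategy is consistent and order optimal. -/

import Mathlib

open MeasureTheory ProbabilityTheory Filter
open scoped BigOperators ENNReal

/-- A deterministic medium-access strategy: it maps the history of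
(sensed channel, observed outcome) pairs to the channel to be sensed in the next slot. -/
def Strategy (N : ℕ) : Type := List (Fin N × Bool) → Fin N

/-- The history of (channel, outcome) pairs accumulated after `j` (0-indexed) slots, given
the full availability table `ω` (`ω j i = true` iff channel `i` is free in slot `j`). -/
def Strategy.hist {N : ℕ} (Γ : Strategy N) (ω : ℕ → Fin N → Bool) :
    ℕ → List (Fin N × Bool)
  | 0 => []
  | j + 1 =>
    Strategy.hist Γ ω j ++
      [(Γ (Strategy.hist Γ ω j), ω j (Γ (Strategy.hist Γ ω j)))]

/-- The channel selected by strategy `Γ` at (0-indexed) slot `j`. -/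
def Strategy.sel {N : ℕ} (Γ : Strategy N) (ω : ℕ → Fin N → Bool) (j : ℕ) : Fin N :=
  Γ (Γ.hist ω j)

/-- Extension of a finite availability table to all time slots. -/
def extendOut {N T : ℕ} (ω : Fin T → Fin N → Bool) : ℕ → Fin N → Bool :=
  fun j i => if h : j < T then ω ⟨j, h⟩ i else false

/-- The probability of observing the availability table `ω` when each channel `i` is free
in each slot independently with probability `θ i`. -/
def outWt {N T : ℕ} (θ : Fin N → ℝ) (ω : Fin T → Fin N → Bool) : ℝ :=
  ∏ j : Fin T, ∏ i : Fin N, (if ω j i then θ i else 1 - θ i)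

/-- `W B θ T Γ`: the expected number of bits transmitted over a block of `T` slots by the
cognitive user employing strategy `Γ`, when `B` bits are sent each time the sensed channel
is free, i.e. `E_θ[∑_{j=1}^T B · Z_{S(j)}(j)]`. -/
noncomputable def W {N : ℕ} (B : ℝ) (θ : Fin N → ℝ) (T : ℕ) (Γ : Strategy N) : ℝ :=
  ∑ ω : Fin T → Fin N → Bool, outWt θ ω *
    ∑ j ∈ Finset.range T, (if extendOut ω j (Γ.sel (extendOut ω) j) then B else 0)

/-- `probSel θ T Γ j i`: the probability that strategy `Γ` selects channel `i` at
(0-indexed) slot `j`, under parameter `θ`. -/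
noncomputable def probSel {N : ℕ} (θ : Fin N → ℝ) (T : ℕ) (Γ : Strategy N)
    (j : ℕ) (i : Fin N) : ℝ :=
  ∑ ω : Fin T → Fin N → Bool, (if Γ.sel (extendOut ω) j = i then outWt θ ω else 0)

/-- `expY θ T Γ i`: the expected number of slots among the first `T` in which strategy `Γ`
senses channel `i`, i.e. `E_θ[Y_i(T)]`. -/
noncomputable def expY {N : ℕ} (θ : Fin N → ℝ) (T : ℕ) (Γ : Strategy N) (i : Fin N) : ℝ :=
  ∑ ω : Fin T → Fin N → Bool, outWt θ ω *
    (((Finset.range T).filter fun j => Γ.sel (extendOut ω) j = i).card : ℝ)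

/-- The throughput loss of strategy `Γ` over a block of `T` slots, relative to always
sensing a best channel `istar`: `L(θ;Γ,T) = T·B·θ_{i*} − W_Γ(θ,T)`. -/
noncomputable def Loss {N : ℕ} (B : ℝ) (θ : Fin N → ℝ) (istar : Fin N) (T : ℕ)
    (Γ : Strategy N) : ℝ :=
  T * B * θ istar - W B θ T Γ

/-- A family of strategies (one for each horizon `T`) is consistent if for every
`θ ∈ [0,1]^N` there are `β < 1` and `C > 0` with `L(θ;Γ_T,T) ≤ C·T^β` for all `T ≥ 1`. -/
def Consistent {N : ℕ} (B : ℝ) (Γ : ℕ → Strategy N) : Prop :=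
  ∀ θ : Fin N → ℝ, (∀ i, θ i ∈ Set.Icc (0:ℝ) 1) →
    ∀ istar : Fin N, (∀ k, θ k ≤ θ istar) →
      ∃ β C : ℝ, β < 1 ∧ 0 < C ∧
        ∀ T : ℕ, 1 ≤ T → Loss B θ istar T (Γ T) ≤ C * (T : ℝ) ^ β

/-- The Bayesian expected throughput of strategy `Γ` under prior `f`. -/
noncomputable def WBayes {N : ℕ} (B : ℝ) (T : ℕ) (Γ : Strategy N)
    (f : Measure (Fin N → ℝ)) : ℝ :=
  ∫ θ, W B θ T Γ ∂f

/-- The optimal Bayesian value `V*(f,T) = sup_Γ W_Γ(f,T)`. -/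
noncomputable def Vstar {N : ℕ} (B : ℝ) (T : ℕ) (f : Measure (Fin N → ℝ)) : ℝ :=
  ⨆ Γ : Strategy N, WBayes B T Γ f

/-- The Bayesian posterior after sensing channel `i` and observing outcome `z`:
`f_{z_i=1}` has density `θ_i / ∫θ_i f(dθ)` w.r.t. `f`, and `f_{z_i=0}` has density
`(1−θ_i) / ∫(1−θ_i) f(dθ)` w.r.t. `f`. -/
noncomputable def posterior {N : ℕ} (f : Measure (Fin N → ℝ)) (i : Fin N) (z : Bool) :
    Measure (Fin N → ℝ) :=
  if z then f.withDensity fun θ => ENNReal.ofReal (θ i / ∫ θ', θ' i ∂f)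
  else f.withDensity fun θ => ENNReal.ofReal ((1 - θ i) / ∫ θ', (1 - θ' i) ∂f)

/-- Kullback–Leibler divergence between Bernoulli(a) and Bernoulli(b). -/
noncomputable def klBernoulli (a b : ℝ) : ℝ :=
  a * Real.log (a / b) + (1 - a) * Real.log ((1 - a) / (1 - b))

/-- The UCB single index of channel `i` given history `h` (the history has length `j − 1`
when the current slot is `j`, 1-indexed): `Λ_i(j) = X_i(j)/Y_i(j) + sqrt(2·ln j/Y_i(j))`,
where `Y_i(j)` is the number of past slots in which channel `i` was sensed and `X_i(j)`
the number of past slots in which it was sensed and found free. -/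
noncomputable def ucbIndex {N : ℕ} (h : List (Fin N × Bool)) (i : Fin N) : ℝ :=
  ((h.filter fun p => p.1 == i && p.2).length : ℝ)
      / ((h.filter fun p => p.1 == i).length : ℝ)
    + Real.sqrt (2 * Real.log (h.length + 1)
      / ((h.filter fun p => p.1 == i).length : ℝ))

/-- The order-optimal single index (UCB) strategy: in the first `N` slots each channel is
sensed once (channel `j` at slot `j`); thereafter the strategy senses a channel maximizing
the index `Λ_i(j)`, ties broken in favor of the lowest channel index. -/
noncomputable def ucbStrategy (N : ℕ) (hN : 0 < N) : Strategy N := fun h => by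
  classical
  exact
    if hlt : h.length < N then ⟨h.length, hlt⟩
    else
      (Finset.univ.filter fun i : Fin N => ∀ k, ucbIndex h k ≤ ucbIndex h i).min'
        (by
          haveI : Nonempty (Fin N) := ⟨⟨0, hN⟩⟩
          obtain ⟨i, -, hi⟩ := Finset.exists_max_image (Finset.univ : Finset (Fin N))
            (ucbIndex h) Finset.univ_nonempty
          exact ⟨i, Finset.mem_filter.mpr
            ⟨Finset.mem_univ _, fun k => hi k (Finset.mem_univ k)⟩⟩)

/-- The number of slots recorded in the history `h` in which channel `i` was sensed. -/
def senseCount {N : ℕ} (h : List (Fin N × Bool)) (i : Fin N) : ℕ :=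
  (h.filter fun p => p.1 == i).length

/-- The number of slots recorded in the history `h` in which channel `i` was sensed
and found free. -/
def freeCount {N : ℕ} (h : List (Fin N × Bool)) (i : Fin N) : ℕ :=
  (h.filter fun p => p.1 == i && p.2).length

/-- The expectation of `f` over availability tables of `T` slots. -/
def tableExpect {N T : ℕ} (θ : Fin N → ℝ) (f : (Fin T → Fin N → Bool) → ℝ) : ℝ :=
  ∑ ω, outWt θ ω * f ω

/-- The exponential supermartingale of channel `i` with parameter `l`, as a function of the
history. -/
noncomputable def expDeviation {N : ℕ} (θ : Fin N → ℝ) (i : Fin N) (l : ℝ)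
    (h : List (Fin N × Bool)) : ℝ :=
  Real.exp (l * (freeCount h i - θ i * senseCount h i) - senseCount h i * l ^ 2 / 8)

section Expectation

variable {N T : ℕ} {θ : Fin N → ℝ}

theorem outWt_nonneg (hθ : ∀ i, θ i ∈ Set.Icc (0 : ℝ) 1) (ω : Fin T → Fin N → Bool) :
    0 ≤ outWt θ ω := by
  refine Finset.prod_nonneg fun j _ => Finset.prod_nonneg fun i _ => ?_
  have := hθ i
  split_ifs
  · exact this.1
  · linarith [this.2]

theorem sum_outWt (θ : Fin N → ℝ) : ∑ ω : Fin T → Fin N → Bool, outWt θ ω = 1 := by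
  unfold outWt
  rw [← Fintype.prod_sum
    (fun (_ : Fin T) (z : Fin N → Bool) => ∏ i, if z i then θ i else 1 - θ i)]
  refine Finset.prod_eq_one fun j _ => ?_
  rw [← Fintype.prod_sum (fun (i : Fin N) (b : Bool) => if b then θ i else 1 - θ i)]
  simp

theorem tableExpect_mono (hθ : ∀ i, θ i ∈ Set.Icc (0 : ℝ) 1)
    {f g : (Fin T → Fin N → Bool) → ℝ} (hfg : ∀ ω, f ω ≤ g ω) :
    tableExpect θ f ≤ tableExpect θ g :=
  Finset.sum_le_sum fun ω _ => mul_le_mul_of_nonneg_left (hfg ω) (outWt_nonneg hθ ω)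

theorem tableExpect_const (θ : Fin N → ℝ) (c : ℝ) :
    tableExpect θ (fun _ : Fin T → Fin N → Bool => c) = c := by
  rw [tableExpect, ← Finset.sum_mul, sum_outWt, one_mul]

theorem tableExpect_add (f g : (Fin T → Fin N → Bool) → ℝ) :
    tableExpect θ (fun ω => f ω + g ω) = tableExpect θ f + tableExpect θ g := by
  simp [tableExpect, mul_add, Finset.sum_add_distrib]

theorem tableExpect_sum {ι : Type*} (s : Finset ι) (f : ι → (Fin T → Fin N → Bool) → ℝ) :
    tableExpect θ (fun ω => ∑ k ∈ s, f k ω) = ∑ k ∈ s, tableExpect θ (f k) := by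
  simp only [tableExpect, Finset.mul_sum]
  exact Finset.sum_comm

theorem tableExpect_const_mul (c : ℝ) (f : (Fin T → Fin N → Bool) → ℝ) :
    tableExpect θ (fun ω => c * f ω) = c * tableExpect θ f := by
  simp only [tableExpect, Finset.mul_sum]
  exact Finset.sum_congr rfl fun ω _ => by ring

/-- The entry of the table at slot `j` and channel `c` may be averaged out against any factor
that does not depend on it. -/
theorem tableExpect_mul_entry (j : Fin T) (c : Fin N) (G : (Fin T → Fin N → Bool) → ℝ)
    (hG : ∀ ω b, G (Function.update ω j (Function.update (ω j) c b)) = G ω) (h : Bool → ℝ) :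
    tableExpect θ (fun ω => G ω * h (ω j c)) =
      tableExpect θ (fun ω => G ω * (θ c * h true + (1 - θ c) * h false)) := by
  classical
  let flip : (Fin T → Fin N → Bool) → (Fin T → Fin N → Bool) := fun ω =>
    Function.update ω j (Function.update (ω j) c (!(ω j c)))
  have hflip : Function.Involutive flip := fun ω => by simp [flip]
  let R : (Fin T → Fin N → Bool) → ℝ := fun ω =>
    ∏ p ∈ Finset.univ.erase (j, c), if ω p.1 p.2 then θ p.2 else 1 - θ p.2
  have hw : ∀ ω : Fin T → Fin N → Bool,
      outWt θ ω = (if ω j c then θ c else 1 - θ c) * R ω := fun ω => by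
    rw [outWt, ← Fintype.prod_prod_type'
      (f := fun (j : Fin T) (i : Fin N) => if ω j i then θ i else 1 - θ i),
      ← Finset.mul_prod_erase _ _ (Finset.mem_univ (j, c))]
  have hR : ∀ ω, R (flip ω) = R ω := fun ω => by
    refine Finset.prod_congr rfl fun p hp => ?_
    have hne : p ≠ (j, c) := (Finset.mem_erase.mp hp).1
    have : flip ω p.1 p.2 = ω p.1 p.2 := by
      by_cases h1 : p.1 = j
      · have h2 : p.2 ≠ c := fun h2 => hne (Prod.ext h1 h2)
        simp [flip, h1, h2]
      · simp [flip, h1]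
    rw [this]
  have hsymm : ∀ f : (Fin T → Fin N → Bool) → ℝ, ∑ ω, (f ω + f (flip ω)) = 2 * ∑ ω, f ω := by
    intro f
    rw [Finset.sum_add_distrib, (hflip.bijective).sum_comp f, two_mul]
  have key : ∀ f : (Fin T → Fin N → Bool) → ℝ, tableExpect θ f =
      (∑ ω, (outWt θ ω * f ω + outWt θ (flip ω) * f (flip ω))) / 2 := fun f => by
    rw [hsymm (fun ω => outWt θ ω * f ω), tableExpect]; ring
  rw [key, key]
  congr 1
  refine Finset.sum_congr rfl fun ω _ => ?_
  have h1 : G (flip ω) = G ω := hG ω _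
  have h2 : flip ω j c = !(ω j c) := by simp [flip]
  simp only [hw, hR, h1, h2]
  cases ω j c <;> simp <;> ring

end Expectation

section History

variable {N T : ℕ}

@[simp]
theorem Strategy.length_hist (Γ : Strategy N) (ω : ℕ → Fin N → Bool) (j : ℕ) :
    (Γ.hist ω j).length = j := by
  induction j with
  | zero => rfl
  | succ j ih => simp [Strategy.hist, ih]

theorem Strategy.hist_congr (Γ : Strategy N) {ω ω' : ℕ → Fin N → Bool} {j : ℕ}
    (h : ∀ k < j, ω k = ω' k) : Γ.hist ω j = Γ.hist ω' j := by
  induction j with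
  | zero => rfl
  | succ j ih =>
    simp only [Strategy.hist, ih fun k hk => h k (hk.trans j.lt_succ_self), h j j.lt_succ_self]

theorem senseCount_hist_succ (Γ : Strategy N) (ω : ℕ → Fin N → Bool) (j : ℕ) (i : Fin N) :
    senseCount (Γ.hist ω (j + 1)) i =
      senseCount (Γ.hist ω j) i + if Γ.sel ω j = i then 1 else 0 := by
  simp only [senseCount, Strategy.hist, List.filter_append, List.length_append, Strategy.sel]
  split_ifs with h <;> simp [h]

theorem freeCount_hist_succ (Γ : Strategy N) (ω : ℕ → Fin N → Bool) (j : ℕ) (i : Fin N) :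
    freeCount (Γ.hist ω (j + 1)) i = freeCount (Γ.hist ω j) i +
      if Γ.sel ω j = i then (if ω j (Γ.sel ω j) then 1 else 0) else 0 := by
  simp only [freeCount, Strategy.hist, List.filter_append, List.length_append, Strategy.sel]
  by_cases h : Γ (Γ.hist ω j) = i
  · cases h' : ω j i <;> simp [h, h']
  · simp [h]

theorem senseCount_le_length (h : List (Fin N × Bool)) (i : Fin N) :
    senseCount h i ≤ h.length :=
  List.length_filter_le _ _

theorem senseCount_hist_mono (Γ : Strategy N) (ω : ℕ → Fin N → Bool) (i : Fin N) :
    Monotone fun j => senseCount (Γ.hist ω j) i :=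
  monotone_nat_of_le_succ fun j => by simp [senseCount_hist_succ]

theorem senseCount_hist_eq_sum (Γ : Strategy N) (ω : ℕ → Fin N → Bool) (i : Fin N) (j : ℕ) :
    senseCount (Γ.hist ω j) i = ∑ k ∈ Finset.range j, if Γ.sel ω k = i then 1 else 0 := by
  induction j with
  | zero => rfl
  | succ j ih => rw [senseCount_hist_succ, Finset.sum_range_succ, ih]

/-- A channel is sensed at most `m` times while its sensing count is below `m`. -/
theorem senseCount_le_add_sum (Γ : Strategy N) (ω : ℕ → Fin N → Bool) (i : Fin N) (m j : ℕ) :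
    senseCount (Γ.hist ω j) i ≤ m + ∑ k ∈ Finset.range j,
      if Γ.sel ω k = i ∧ m ≤ senseCount (Γ.hist ω k) i then 1 else 0 := by
  induction j with
  | zero => simp [Strategy.hist, senseCount]
  | succ j ih =>
    rw [Finset.sum_range_succ, senseCount_hist_succ]
    by_cases h1 : Γ.sel ω j = i <;> by_cases h2 : m ≤ senseCount (Γ.hist ω j) i <;>
      simp only [h1, h2, and_self, and_true, and_false, if_true, if_false] <;>
      omega

/-- The tower property: the outcome in slot `j` is averaged out given the history. -/
theorem tableExpect_hist_mul_outcome {θ : Fin N → ℝ} (Γ : Strategy N) {j : ℕ} (hj : j < T)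
    (G : List (Fin N × Bool) → ℝ) (h : Fin N → Bool → ℝ) :
    tableExpect (T := T) θ (fun ω => G (Γ.hist (extendOut ω) j) *
        h (Γ.sel (extendOut ω) j) (extendOut ω j (Γ.sel (extendOut ω) j))) =
      tableExpect (T := T) θ (fun ω => G (Γ.hist (extendOut ω) j) *
        (θ (Γ.sel (extendOut ω) j) * h (Γ.sel (extendOut ω) j) true +
          (1 - θ (Γ.sel (extendOut ω) j)) * h (Γ.sel (extendOut ω) j) false)) := by
  classical
  let F : Fin N → (Fin T → Fin N → Bool) → ℝ := fun c ω =>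
    if Γ.sel (extendOut ω) j = c then G (Γ.hist (extendOut ω) j) else 0
  have hF : ∀ c ω b,
      F c (Function.update ω ⟨j, hj⟩ (Function.update (ω ⟨j, hj⟩) c b)) = F c ω := by
    intro c ω b
    have : Γ.hist (extendOut
        (Function.update ω ⟨j, hj⟩ (Function.update (ω ⟨j, hj⟩) c b))) j =
        Γ.hist (extendOut ω) j := by
      refine Γ.hist_congr fun k hk => ?_
      funext i
      simp [extendOut, hk.trans hj, Function.update_of_ne, Fin.ext_iff, hk.ne]
    exact congrArg (fun l => if Γ l = c then G l else 0) this
  have hsplit : ∀ g : Fin N → (Fin T → Fin N → Bool) → ℝ,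
      tableExpect (T := T) θ (fun ω =>
        G (Γ.hist (extendOut ω) j) * g (Γ.sel (extendOut ω) j) ω) =
      ∑ c, tableExpect (T := T) θ (fun ω => F c ω * g c ω) := by
    intro g
    rw [← tableExpect_sum]
    congr 1
    funext ω
    simp [F, ite_mul]
  have hout : ∀ (ω : Fin T → Fin N → Bool) c, extendOut ω j c = ω ⟨j, hj⟩ c := fun ω c => by
    simp [extendOut, hj]
  simp only [hout]
  rw [hsplit fun c ω => h c (ω ⟨j, hj⟩ c),
    hsplit fun c _ => θ c * h c true + (1 - θ c) * h c false]
  exact Finset.sum_congr rfl fun c _ => tableExpect_mul_entry _ c _ (hF c) (h c)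

end History

section Concentration

variable {N T : ℕ} {θ : Fin N → ℝ}

/-- Hoeffding's lemma for a Bernoulli variable. -/
theorem bernoulli_exp_le {p : ℝ} (hp : p ∈ Set.Icc (0 : ℝ) 1) (l : ℝ) :
    p * Real.exp (l * (1 - p)) + (1 - p) * Real.exp (l * (0 - p)) ≤ Real.exp (l ^ 2 / 8) := by
  have hint : ∀ f : ℝ → ℝ, ∫ x, f x ∂(bernoulliMeasure (1 : ℝ) 0 ⟨p, hp⟩) =
      p * f 1 + (1 - p) * f 0 := by
    intro f
    rw [bernoulliMeasure_def, integral_add_measure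
      ((integrable_dirac (by simp)).smul_measure_nnreal)
      ((integrable_dirac (by simp)).smul_measure_nnreal), integral_smul_nnreal_measure,
      integral_smul_nnreal_measure, integral_dirac, integral_dirac]
    rfl
  have hb : ∀ᵐ x ∂(bernoulliMeasure (1 : ℝ) 0 ⟨p, hp⟩), id x ∈ Set.Icc (0 : ℝ) 1 := by
    rw [bernoulliMeasure_def, ae_add_measure_iff]
    constructor <;> refine Measure.ae_smul_measure ?_ _ <;> simp
  have h := (hasSubgaussianMGF_of_mem_Icc aemeasurable_id hb).mgf_le l
  simp only [mgf, hint, id] at h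
  have e : l * (1 - (p * 1 + (1 - p) * 0)) = l * (1 - p) := by ring
  have e' : l * (0 - (p * 1 + (1 - p) * 0)) = l * (0 - p) := by ring
  rw [e, e'] at h
  refine h.trans_eq ?_
  congr 1
  simp
  ring

theorem tableExpect_expDeviation_le_one (hθ : ∀ i, θ i ∈ Set.Icc (0 : ℝ) 1) (Γ : Strategy N)
    (i : Fin N) (l : ℝ) {j : ℕ} (hj : j ≤ T) :
    tableExpect (T := T) θ (fun ω => expDeviation θ i l (Γ.hist (extendOut ω) j)) ≤ 1 := by
  induction j with
  | zero => simp [Strategy.hist, expDeviation, freeCount, senseCount, tableExpect_const]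
  | succ j ih =>
    refine le_trans ?_ (ih (by omega))
    let h : Fin N → Bool → ℝ := fun c z =>
      if c = i then Real.exp (l * ((if z then 1 else 0) - θ i) - l ^ 2 / 8) else 1
    have hstep : ∀ ω : Fin T → Fin N → Bool,
        expDeviation θ i l (Γ.hist (extendOut ω) (j + 1)) =
          expDeviation θ i l (Γ.hist (extendOut ω) j) *
            h (Γ.sel (extendOut ω) j) (extendOut ω j (Γ.sel (extendOut ω) j)) := by
      intro ω
      simp only [expDeviation, freeCount_hist_succ, senseCount_hist_succ, h]
      split_ifs
      · rw [← Real.exp_add]; congr 1; push_cast; ring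
      · rw [← Real.exp_add]; congr 1; push_cast; ring
      · simp
    simp only [hstep]
    rw [tableExpect_hist_mul_outcome Γ (by omega) (expDeviation θ i l) h]
    refine tableExpect_mono hθ fun ω => mul_le_of_le_one_right (Real.exp_pos _).le ?_
    by_cases hc : Γ.sel (extendOut ω) j = i
    · simp only [h, hc, if_true, Bool.false_eq_true, if_false, Real.exp_sub _ (l ^ 2 / 8)]
      rw [mul_div_assoc', mul_div_assoc', ← add_div, div_le_one (Real.exp_pos _)]
      exact bernoulli_exp_le (hθ i) l
    · simp [h, hc]

/-- Markov's inequality for the exponential supermartingale. -/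
theorem tableExpect_expDeviation_ge (hθ : ∀ i, θ i ∈ Set.Icc (0 : ℝ) 1) (Γ : Strategy N)
    (i : Fin N) (l c : ℝ) {j : ℕ} (hj : j ≤ T) :
    tableExpect (T := T) θ (fun ω =>
      if Real.exp c ≤ expDeviation θ i l (Γ.hist (extendOut ω) j) then 1 else 0) ≤
        Real.exp (-c) := by
  calc _ ≤ tableExpect (T := T) θ (fun ω =>
        Real.exp (-c) * expDeviation θ i l (Γ.hist (extendOut ω) j)) := by
        refine tableExpect_mono hθ fun ω => ?_
        split_ifs with h
        · calc (1 : ℝ) = Real.exp (-c) * Real.exp c := by rw [← Real.exp_add]; simp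
            _ ≤ _ := by gcongr
        · exact mul_nonneg (Real.exp_pos _).le (Real.exp_pos _).le
    _ ≤ Real.exp (-c) := by
        rw [tableExpect_const_mul]
        exact mul_le_of_le_one_right (Real.exp_pos _).le
          (tableExpect_expDeviation_le_one hθ Γ i l hj)

theorem exp_le_expDeviation {h : List (Fin N × Bool)} {i : Fin N} {s L : ℝ} (hs : 0 < s)
    (hsc : (senseCount h i : ℝ) = s) (hL : 0 ≤ L)
    (hdev : θ i + √(2 * L / s) ≤ freeCount h i / s) :
    Real.exp (4 * L) ≤ expDeviation θ i (4 * √(2 * L / s)) h := by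
  rw [expDeviation, hsc, Real.exp_le_exp]
  have hsq : s * √(2 * L / s) ^ 2 = 2 * L := by
    rw [Real.sq_sqrt (by positivity)]; field_simp
  rw [le_div_iff₀ hs] at hdev
  nlinarith [Real.sqrt_nonneg (2 * L / s), mul_le_mul_of_nonneg_left hdev
    (Real.sqrt_nonneg (2 * L / s))]

theorem exp_le_expDeviation_neg {h : List (Fin N × Bool)} {i : Fin N} {s L : ℝ} (hs : 0 < s)
    (hsc : (senseCount h i : ℝ) = s) (hL : 0 ≤ L)
    (hdev : freeCount h i / s + √(2 * L / s) ≤ θ i) :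
    Real.exp (4 * L) ≤ expDeviation θ i (-(4 * √(2 * L / s))) h := by
  rw [expDeviation, hsc, Real.exp_le_exp]
  have hsq : s * √(2 * L / s) ^ 2 = 2 * L := by
    rw [Real.sq_sqrt (by positivity)]; field_simp
  rw [← le_sub_iff_add_le, div_le_iff₀ hs] at hdev
  nlinarith [Real.sqrt_nonneg (2 * L / s), mul_le_mul_of_nonneg_left hdev
    (Real.sqrt_nonneg (2 * L / s))]

end Concentration

section Loss

variable {N T : ℕ} {θ : Fin N → ℝ}

theorem W_eq_tableExpect (B : ℝ) (Γ : Strategy N) :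
    W B θ T Γ = tableExpect (T := T) θ (fun ω =>
      ∑ j ∈ Finset.range T, B * θ (Γ.sel (extendOut ω) j)) := by
  rw [tableExpect_sum]
  calc W B θ T Γ = ∑ j ∈ Finset.range T, tableExpect (T := T) θ (fun ω =>
        if extendOut ω j (Γ.sel (extendOut ω) j) then B else 0) := by
        rw [← tableExpect_sum]; rfl
    _ = _ := Finset.sum_congr rfl fun j hj => by
        have := tableExpect_hist_mul_outcome (θ := θ) Γ (Finset.mem_range.mp hj) (fun _ => 1)
          (fun _ z => if z then B else 0)
        simpa [mul_comm B] using this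

/-- The loss is the sum over channels of the gap times the expected sensing count. -/
theorem Loss_eq_sum_gap_mul (B : ℝ) (istar : Fin N) (Γ : Strategy N) :
    Loss B θ istar T Γ = B * ∑ i, (θ istar - θ i) *
      tableExpect (T := T) θ (fun ω => (senseCount (Γ.hist (extendOut ω) T) i : ℝ)) := by
  have hpt : ∀ ω : Fin T → Fin N → Bool,
      ∑ i, (θ istar - θ i) * (senseCount (Γ.hist (extendOut ω) T) i : ℝ) =
        T * θ istar - ∑ j ∈ Finset.range T, θ (Γ.sel (extendOut ω) j) := by
    intro ω
    simp only [senseCount_hist_eq_sum, Nat.cast_sum, Nat.cast_ite, Nat.cast_one, Nat.cast_zero,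
      Finset.mul_sum]
    rw [Finset.sum_comm]
    simp
  simp only [← tableExpect_const_mul, ← tableExpect_sum]
  simp only [hpt, Loss, W_eq_tableExpect, ← Finset.mul_sum, tableExpect_const_mul]
  simp only [tableExpect, mul_sub, Finset.sum_sub_distrib, ← Finset.sum_mul, sum_outWt]
  ring

theorem W_nonneg {B : ℝ} (hB : 0 ≤ B) (hθ : ∀ i, θ i ∈ Set.Icc (0 : ℝ) 1) (Γ : Strategy N) :
    0 ≤ W B θ T Γ :=
  Finset.sum_nonneg fun ω _ => mul_nonneg (outWt_nonneg hθ ω) <|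
    Finset.sum_nonneg fun j _ => by split_ifs <;> simp [hB]

end Loss

section UCB

variable {N T : ℕ} {θ : Fin N → ℝ}

theorem ucbStrategy_sel_of_lt (hN : 0 < N) (ω : ℕ → Fin N → Bool) {j : ℕ} (hj : j < N) :
    (ucbStrategy N hN).sel ω j = ⟨j, hj⟩ := by
  simp [Strategy.sel, ucbStrategy, hj]

theorem ucbIndex_le_sel (hN : 0 < N) (ω : ℕ → Fin N → Bool) {j : ℕ} (hj : N ≤ j) (k : Fin N) :
    ucbIndex ((ucbStrategy N hN).hist ω j) k ≤
      ucbIndex ((ucbStrategy N hN).hist ω j) ((ucbStrategy N hN).sel ω j) := by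
  classical
  have key : ∀ h : List (Fin N × Bool), N ≤ h.length →
      ucbIndex h k ≤ ucbIndex h (ucbStrategy N hN h) := by
    intro h hh
    rw [ucbStrategy, dif_neg (by omega)]
    exact ((Finset.mem_filter (p := fun i => ∀ k, ucbIndex h k ≤ ucbIndex h i)).mp
      (Finset.min'_mem _ _)).2 k
  exact key _ (by simpa using hj)

theorem ucbStrategy_senseCount_pos (hN : 0 < N) (ω : ℕ → Fin N → Bool) {j : ℕ} (hj : N ≤ j)
    (i : Fin N) : 1 ≤ senseCount ((ucbStrategy N hN).hist ω j) i := by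
  have h : 1 ≤ senseCount ((ucbStrategy N hN).hist ω (i + 1)) i := by
    rw [senseCount_hist_succ, ucbStrategy_sel_of_lt hN ω i.isLt]
    simp
  exact h.trans (senseCount_hist_mono _ ω i (by have := i.isLt; omega))

theorem ucbStrategy_senseCount_eq_zero (hN : 0 < N) (ω : ℕ → Fin N → Bool) (i : Fin N) {j : ℕ}
    (hj : j ≤ i) : senseCount ((ucbStrategy N hN).hist ω j) i = 0 := by
  rw [senseCount_hist_eq_sum]
  refine Finset.sum_eq_zero fun k hk => if_neg ?_
  have hki : k < i := (Finset.mem_range.mp hk).trans_le hj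
  rw [ucbStrategy_sel_of_lt hN ω (hki.trans i.isLt), Fin.ext_iff]
  exact hki.ne

/-- If a suboptimal channel maximizes the index although it has been sensed often, then its own
estimate or that of the best channel deviates by the confidence width. -/
theorem deviation_of_ucbIndex_le {h : List (Fin N × Bool)} {i k : Fin N} (hik : θ i < θ k)
    (hle : ucbIndex h k ≤ ucbIndex h i) (hi : 1 ≤ senseCount h i)
    (hcount : 8 * Real.log (h.length + 1) ≤ (θ k - θ i) ^ 2 * senseCount h i) :
    θ i + √(2 * Real.log (h.length + 1) / senseCount h i) ≤ freeCount h i / senseCount h i ∨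
      freeCount h k / senseCount h k + √(2 * Real.log (h.length + 1) / senseCount h k) ≤ θ k := by
  by_contra! hc
  obtain ⟨h1, h2⟩ := hc
  have hi' : (0 : ℝ) < senseCount h i := by exact_mod_cast hi
  have hsqrt : √(2 * Real.log (h.length + 1) / senseCount h i) ≤ (θ k - θ i) / 2 := by
    refine Real.sqrt_le_iff.mpr ⟨by linarith, ?_⟩
    rw [div_le_iff₀ hi']
    nlinarith
  change (freeCount h k : ℝ) / senseCount h k +
      √(2 * Real.log (h.length + 1) / senseCount h k) ≤
    freeCount h i / senseCount h i + √(2 * Real.log (h.length + 1) / senseCount h i) at hle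
  linarith

/-- The probability that UCB senses, in slot `j`, a suboptimal channel already sensed often. -/
theorem tableExpect_ucb_overplay_le (hN : 0 < N) (hθ : ∀ i, θ i ∈ Set.Icc (0 : ℝ) 1)
    {i istar : Fin N} (hi : θ i < θ istar) {m j : ℕ} (hm : 1 ≤ m) (hj : j < T)
    (hcount : 8 * Real.log T ≤ (θ istar - θ i) ^ 2 * m) :
    tableExpect (T := T) θ (fun ω =>
      if (ucbStrategy N hN).sel (extendOut ω) j = i ∧
        m ≤ senseCount ((ucbStrategy N hN).hist (extendOut ω) j) i then (1 : ℝ) else 0) ≤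
      2 / ((j : ℝ) + 1) ^ 2 := by
  set Γ := ucbStrategy N hN with hΓ
  set L := Real.log ((j : ℝ) + 1) with hL
  have hL0 : 0 ≤ L := Real.log_nonneg (by linarith [(Nat.cast_nonneg j : (0 : ℝ) ≤ j)])
  let A : ℕ → (Fin T → Fin N → Bool) → ℝ := fun s ω =>
    if Real.exp (4 * L) ≤ expDeviation θ i (4 * √(2 * L / s)) (Γ.hist (extendOut ω) j)
      then 1 else 0
  let D : ℕ → (Fin T → Fin N → Bool) → ℝ := fun s ω =>
    if Real.exp (4 * L) ≤ expDeviation θ istar (-(4 * √(2 * L / s))) (Γ.hist (extendOut ω) j)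
      then 1 else 0
  have hA0 : ∀ s ω, 0 ≤ A s ω := fun s ω => by simp only [A]; split_ifs <;> norm_num
  have hD0 : ∀ s ω, 0 ≤ D s ω := fun s ω => by simp only [D]; split_ifs <;> norm_num
  have hpt : ∀ ω : Fin T → Fin N → Bool,
      (if Γ.sel (extendOut ω) j = i ∧ m ≤ senseCount (Γ.hist (extendOut ω) j) i
        then (1 : ℝ) else 0) ≤ ∑ s ∈ Finset.Icc 1 j, (A s ω + D s ω) := by
    intro ω
    split_ifs with hc
    swap
    · exact Finset.sum_nonneg fun s _ => add_nonneg (hA0 s ω) (hD0 s ω)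
    obtain ⟨hsel, hms⟩ := hc
    have hNj : N ≤ j := by
      by_contra! hlt
      rw [hΓ, ucbStrategy_sel_of_lt hN _ hlt] at hsel
      have := ucbStrategy_senseCount_eq_zero hN (extendOut ω) i (j := j) (by simp [← hsel])
      rw [hΓ] at hms
      omega
    have hle := ucbIndex_le_sel hN (extendOut ω) hNj istar
    rw [← hΓ, hsel] at hle
    have hmem : ∀ k, senseCount (Γ.hist (extendOut ω) j) k ∈ Finset.Icc 1 j := fun k =>
      Finset.mem_Icc.mpr ⟨ucbStrategy_senseCount_pos hN _ hNj k,
        (senseCount_le_length _ _).trans_eq (by simp)⟩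
    have hpos : ∀ k, (0 : ℝ) < senseCount (Γ.hist (extendOut ω) j) k := fun k => by
      exact_mod_cast (Finset.mem_Icc.mp (hmem k)).1
    have hcount' : 8 * Real.log (((Γ.hist (extendOut ω) j).length : ℝ) + 1) ≤
        (θ istar - θ i) ^ 2 * senseCount (Γ.hist (extendOut ω) j) i := by
      calc _ ≤ 8 * Real.log T := by
            rw [Strategy.length_hist]
            gcongr
            exact_mod_cast hj
        _ ≤ _ := hcount
        _ ≤ _ := by gcongr
    have hsum : ∀ k, A (senseCount (Γ.hist (extendOut ω) j) k) ω +
        D (senseCount (Γ.hist (extendOut ω) j) k) ω ≤ ∑ s ∈ Finset.Icc 1 j, (A s ω + D s ω) :=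
      fun k => Finset.single_le_sum (f := fun s => A s ω + D s ω)
        (fun s _ => add_nonneg (hA0 s ω) (hD0 s ω)) (hmem k)
    rcases deviation_of_ucbIndex_le hi hle (Finset.mem_Icc.mp (hmem i)).1 hcount' with hd | hd
    · rw [Strategy.length_hist] at hd
      have : A (senseCount (Γ.hist (extendOut ω) j) i) ω = 1 :=
        if_pos (exp_le_expDeviation (hpos i) rfl hL0 hd)
      linarith [hsum i, hD0 (senseCount (Γ.hist (extendOut ω) j) i) ω]
    · rw [Strategy.length_hist] at hd
      have : D (senseCount (Γ.hist (extendOut ω) j) istar) ω = 1 :=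
        if_pos (exp_le_expDeviation_neg (hpos istar) rfl hL0 hd)
      linarith [hsum istar, hA0 (senseCount (Γ.hist (extendOut ω) j) istar) ω]
  refine (tableExpect_mono hθ hpt).trans ?_
  rw [tableExpect_sum]
  have hexp : Real.exp (-(4 * L)) = 1 / ((j : ℝ) + 1) ^ 4 := by
    rw [Real.exp_neg, show 4 * L = (4 : ℕ) * L by norm_num, Real.exp_nat_mul, hL,
      Real.exp_log (by positivity), one_div]
  calc ∑ s ∈ Finset.Icc 1 j, tableExpect θ (fun ω => A s ω + D s ω)
      ≤ ∑ s ∈ Finset.Icc 1 j, 2 / ((j : ℝ) + 1) ^ 4 := by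
        refine Finset.sum_le_sum fun s _ => ?_
        rw [tableExpect_add]
        have h1 := tableExpect_expDeviation_ge hθ Γ i (4 * √(2 * L / s)) (4 * L) hj.le
        have h2 := tableExpect_expDeviation_ge hθ Γ istar (-(4 * √(2 * L / s))) (4 * L) hj.le
        rw [hexp] at h1 h2
        calc _ ≤ 1 / ((j : ℝ) + 1) ^ 4 + 1 / ((j : ℝ) + 1) ^ 4 := add_le_add h1 h2
          _ = _ := by ring
    _ = j * (2 / ((j : ℝ) + 1) ^ 4) := by simp
    _ ≤ 2 / ((j : ℝ) + 1) ^ 2 := by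
        rw [mul_div_assoc', div_le_div_iff₀ (by positivity) (by positivity)]
        have hj0 : (0 : ℝ) ≤ j := Nat.cast_nonneg j
        nlinarith [mul_nonneg (sq_nonneg ((j : ℝ) + 1))
          (show (0 : ℝ) ≤ ((j : ℝ) + 1) ^ 2 - j by nlinarith)]

theorem sum_two_div_succ_sq_le (T : ℕ) :
    ∑ j ∈ Finset.range T, 2 / ((j : ℝ) + 1) ^ 2 ≤ Real.pi ^ 2 / 3 := by
  have h := sum_le_hasSum (Finset.range (T + 1)) (fun _ _ => by positivity) hasSum_zeta_two
  rw [Finset.sum_range_succ'] at h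
  have e : ∑ j ∈ Finset.range T, 2 / ((j : ℝ) + 1) ^ 2 =
      2 * ∑ j ∈ Finset.range T, 1 / ((j + 1 : ℕ) : ℝ) ^ 2 := by
    rw [Finset.mul_sum]
    exact Finset.sum_congr rfl fun j _ => by push_cast; ring
  rw [e]
  simp at h ⊢
  linarith

/-- The expected number of times UCB senses a suboptimal channel is logarithmic. -/
theorem tableExpect_ucb_senseCount_le (hN : 0 < N) (hθ : ∀ i, θ i ∈ Set.Icc (0 : ℝ) 1)
    {i istar : Fin N} (hi : θ i < θ istar) (hT : 2 ≤ T) :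
    tableExpect (T := T) θ (fun ω =>
      (senseCount ((ucbStrategy N hN).hist (extendOut ω) T) i : ℝ)) ≤
      8 * Real.log T / (θ istar - θ i) ^ 2 + (1 + Real.pi ^ 2 / 3) := by
  have hgap : 0 < (θ istar - θ i) ^ 2 := by have := sub_pos.mpr hi; positivity
  have hlog : 0 < Real.log T := Real.log_pos (by exact_mod_cast hT)
  set m := ⌈8 * Real.log T / (θ istar - θ i) ^ 2⌉₊ with hm
  have hm1 : 1 ≤ m := Nat.one_le_ceil_iff.mpr (by positivity)
  have hcount : 8 * Real.log T ≤ (θ istar - θ i) ^ 2 * m := by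
    rw [← div_le_iff₀' hgap]
    exact Nat.le_ceil _
  have hmle : (m : ℝ) ≤ 8 * Real.log T / (θ istar - θ i) ^ 2 + 1 :=
    (Nat.ceil_lt_add_one (by positivity)).le
  calc _ ≤ tableExpect (T := T) θ (fun ω => (m : ℝ) + ∑ k ∈ Finset.range T,
        if (ucbStrategy N hN).sel (extendOut ω) k = i ∧
          m ≤ senseCount ((ucbStrategy N hN).hist (extendOut ω) k) i then (1 : ℝ) else 0) :=
        tableExpect_mono hθ fun ω => by
          exact_mod_cast senseCount_le_add_sum (ucbStrategy N hN) (extendOut ω) i m T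
    _ ≤ m + ∑ k ∈ Finset.range T, 2 / ((k : ℝ) + 1) ^ 2 := by
        rw [tableExpect_add, tableExpect_const, tableExpect_sum]
        gcongr with k hk
        exact tableExpect_ucb_overplay_le hN hθ hi hm1 (Finset.mem_range.mp hk) hcount
    _ ≤ _ := by linarith [sum_two_div_succ_sq_le T]

end UCB

/-- **UCB loss bound, consistency and order optimality.** For `N ≥ 2` and
any `θ ∈ [0,1]^N` with maximal coordinate `θ_{i*}`, the loss of the single-index strategy
over a block of length `T > N` satisfies
`L(θ;Γ_UCB,T) ≤ B·[∑_{i: θ_i<θ_{i*}} 8·ln T/(θ_{i*} − θ_i) + (1 + π²/3)·∑_i (θ_{i*} − θ_i)]`;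
in particular `L(θ;Γ_UCB,T) = O(ln T)` for every fixed `θ`. -/
theorem ucb_loss_logarithmic {N : ℕ} (hN : 2 ≤ N) (B : ℝ) (hB : 0 < B)
    (θ : Fin N → ℝ) (hθ : ∀ i, θ i ∈ Set.Icc (0:ℝ) 1)
    (istar : Fin N) (hmax : ∀ k, θ k ≤ θ istar) :
    letI : DecidablePred fun i : Fin N => θ i < θ istar := Classical.decPred _
    (∀ T : ℕ, N < T →
      Loss B θ istar T (ucbStrategy N (by omega)) ≤
        B * ((∑ i ∈ Finset.univ.filter fun i : Fin N => θ i < θ istar,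
                8 * Real.log T / (θ istar - θ i))
             + (1 + Real.pi ^ 2 / 3) * ∑ i : Fin N, (θ istar - θ i))) ∧
    ∃ C : ℝ, 0 < C ∧ ∀ T : ℕ, 2 ≤ T →
      Loss B θ istar T (ucbStrategy N (by omega)) ≤ C * Real.log T := by
  classical
  have hN0 : 0 < N := by omega
  have hbound : ∀ T : ℕ, N < T → Loss B θ istar T (ucbStrategy N hN0) ≤
      B * ((∑ i with θ i < θ istar, 8 * Real.log T / (θ istar - θ i)) +
        (1 + Real.pi ^ 2 / 3) * ∑ i : Fin N, (θ istar - θ i)) := by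
    intro T hT
    rw [Loss_eq_sum_gap_mul, Finset.sum_filter,
      Finset.mul_sum (Finset.univ : Finset (Fin N)) _ (1 + Real.pi ^ 2 / 3),
      ← Finset.sum_add_distrib]
    gcongr with i
    split_ifs with hi
    · have hgap := sub_pos.mpr hi
      calc _ ≤ (θ istar - θ i) *
            (8 * Real.log T / (θ istar - θ i) ^ 2 + (1 + Real.pi ^ 2 / 3)) := by
            gcongr
            exact tableExpect_ucb_senseCount_le hN0 hθ hi (by omega)
        _ = _ := by field_simp
    · have : θ istar - θ i = 0 := by linarith [hmax i]
      simp [this]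
  refine ⟨fun T hT => ?_, ?_⟩
  · convert hbound T hT
  · set S := ∑ i with θ i < θ istar, 8 / (θ istar - θ i) with hS
    set R := (1 + Real.pi ^ 2 / 3) * ∑ i : Fin N, (θ istar - θ i) with hR
    have hS0 : 0 ≤ S := Finset.sum_nonneg fun i hi => by
      have := sub_pos.mpr (Finset.mem_filter.mp hi).2
      positivity
    have hR0 : 0 ≤ R :=
      mul_nonneg (by positivity) (Finset.sum_nonneg fun i _ => sub_nonneg.mpr (hmax i))
    have hlog2 : 0 < Real.log 2 := Real.log_pos (by norm_num)
    refine ⟨B * (S + (R + N) / Real.log 2), by positivity, fun T hT => ?_⟩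
    have hlogT : Real.log 2 ≤ Real.log T :=
      Real.log_le_log (by norm_num) (by exact_mod_cast hT)
    have hratio : R + N ≤ (R + N) / Real.log 2 * Real.log T := by
      rw [div_mul_eq_mul_div, le_div_iff₀ hlog2]
      gcongr
    have hSlog : 0 ≤ S * Real.log T := mul_nonneg hS0 (hlog2.le.trans hlogT)
    rw [mul_assoc]
    rcases lt_or_ge N T with hT' | hT'
    · refine (hbound T hT').trans ?_
      have e : ∑ i with θ i < θ istar, 8 * Real.log T / (θ istar - θ i) = S * Real.log T := by
        rw [hS, Finset.sum_mul]
        exact Finset.sum_congr rfl fun i _ => by ring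
      rw [e]
      gcongr
      linarith [(Nat.cast_nonneg N : (0 : ℝ) ≤ N)]
    · have hW := W_nonneg (T := T) hB.le hθ (ucbStrategy N hN0)
      calc Loss B θ istar T (ucbStrategy N hN0) ≤ T * B * θ istar := sub_le_self _ hW
        _ ≤ T * B := mul_le_of_le_one_right (by positivity) (hθ istar).2
        _ = B * T := mul_comm _ _
        _ ≤ B * ((S + (R + N) / Real.log 2) * Real.log T) := by
            gcongr
            have : (T : ℝ) ≤ N := by exact_mod_cast hT'
            linarith
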